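/- Let n ≥ 1, let R be a commutative ring, and let a_{i,j} ∈ R for 1 ≤ i ≤ j ≤ n and b_{i,j} ∈ R for 1 ≤ i < j ≤ n. Define the n × n matrix M_F over R by (M_F)_{i,j} = a_{i,j} + b_{i,j} if i < j, (M_F)_{i,j} = a_{j,i} − b_{j,i} if i > j, and (M_F)_{i,i} = a_{i,i}. For a Brauer diagram μ of size n with the F-labeling (both top and bottom points labeled 1,…,n from left to right), define the weight w_F(μ) = ∏_{cups {T_i,T_j}, i<j} b_{i,j} · ∏_{caps {B_i,B_j}, i<j} b_{i,j} · ∏_{arcs {T_i,B_j}} a_{min(i,j),max(i,j)}. Then det(M_F) = ∑_{μ} (−1)^{χ(μ)} w_F(μ), where the sum runs over all Brauer diagrams μ of size n. -/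

import Mathlib

open Finset

/-- Vertices of a Brauer diagram of size `n`: `Sum.inl i` is the top point `T i`
and `Sum.inr m` is the bottom point `B m` (positions indexed left to right by `Fin n`). -/
abbrev BVertex (n : ℕ) := Fin n ⊕ Fin n

/-- A Brauer diagram of size `n` is a perfect matching of the `2n` vertices,
encoded as a fixed-point-free involution. -/
def BrauerDiagram (n : ℕ) :=
  {f : Equiv.Perm (BVertex n) // (∀ x, f (f x) = x) ∧ (∀ x, f x ≠ x)}

instance (n : ℕ) : Fintype (BrauerDiagram n) := Subtype.fintype _

/-- An edge of a Brauer diagram: a cup joins two top points, a cap joins two bottom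
points, and an arc joins a top point and a bottom point. In `cup i j` and `cap i j`
we maintain `i < j`, and in `arc i m`, `i` is the top position and `m` the bottom one. -/
inductive BEdge (n : ℕ)
  | cup : Fin n → Fin n → BEdge n
  | cap : Fin n → Fin n → BEdge n
  | arc : Fin n → Fin n → BEdge n
deriving DecidableEq

/-- The canonical edge with endpoints `x` and `y`. -/
def edgeOf {n : ℕ} : BVertex n → BVertex n → BEdge n
  | .inl i, .inl j => .cup (min i j) (max i j)
  | .inr i, .inr j => .cap (min i j) (max i j)
  | .inl i, .inr m => .arc i m
  | .inr m, .inl i => .arc i m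

/-- Whether two edges of a Brauer diagram cross. -/
def crosses {n : ℕ} : BEdge n → BEdge n → Bool
  | .cup i j, .cup k l => decide ((i < k ∧ k < j ∧ j < l) ∨ (k < i ∧ i < l ∧ l < j))
  | .cap i j, .cap k l => decide ((i < k ∧ k < j ∧ j < l) ∨ (k < i ∧ i < l ∧ l < j))
  | .cup _ _, .cap _ _ => false
  | .cap _ _, .cup _ _ => false
  | .cup i j, .arc k _ => decide (i < k ∧ k < j)
  | .arc k _, .cup i j => decide (i < k ∧ k < j)
  | .cap i j, .arc _ m => decide (i < m ∧ m < j)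
  | .arc _ m, .cap i j => decide (i < m ∧ m < j)
  | .arc i m, .arc j m' => decide ((i < j ∧ m' < m) ∨ (j < i ∧ m < m'))

/-- The set of edges of a Brauer diagram. -/
def edges {n : ℕ} (μ : BrauerDiagram n) : Finset (BEdge n) :=
  Finset.univ.image fun x => edgeOf x (μ.1 x)

/-- The crossing number of a Brauer diagram: the number of unordered pairs of
its edges that cross. -/
def crossingNumber {n : ℕ} (μ : BrauerDiagram n) : ℕ :=
  ((edges μ).offDiag.filter fun p => crosses p.1 p.2 = true).card / 2

/-- The `F`-weight of an edge: both rows are labeled `1, …, n` left to right. -/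
def wF {n : ℕ} {R : Type*} [CommRing R] (a b : Fin n → Fin n → R) : BEdge n → R
  | .cup i j => b i j
  | .cap i j => b i j
  | .arc i m => a (min i m) (max i m)

/-- The matrix `M_F` built from a symmetric part `a` and a skew part `b`. -/
def MF {n : ℕ} {R : Type*} [CommRing R] (a b : Fin n → Fin n → R) :
    Matrix (Fin n) (Fin n) R :=
  Matrix.of fun i j =>
    if i < j then a i j + b i j else if j < i then a j i - b j i else a i i


/-- Composing with a permutation multiplies the product of an antisymmetric function over the
increasing pairs of a finite linear order by the sign of the permutation. -/
theorem Equiv.Perm.prod_ite_lt_comp_eq_sign_mul_prod {α R : Type*} [Fintype α] [LinearOrder α]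
    [CommRing R] (σ : Equiv.Perm α) {f : α → α → R} (hf : ∀ i j, f i j = -f j i) :
    ∏ i, ∏ j, (if i < j then f (σ i) (σ j) else 1) =
      σ.sign * ∏ i, ∏ j, (if i < j then f i j else 1) := by
  have key (g : α → α → R) (o : Fin (Fintype.card α) ≃o α) :
      ∏ i, ∏ j, (if i < j then g i j else 1) = ∏ i, ∏ j ∈ Finset.Ioi i, g (o i) (o j) := by
    rw [← o.toEquiv.prod_comp]
    refine Finset.prod_congr rfl fun i _ ↦ ?_
    rw [← o.toEquiv.prod_comp, ← Finset.prod_filter]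
    simp [Finset.filter_lt_eq_Ioi]
  let o : Fin (Fintype.card α) ≃o α := Fintype.orderIsoFinOfCardEq α rfl
  rw [key _ o, key _ o, ← Equiv.Perm.sign_permCongr o.toEquiv.symm σ,
    ← Equiv.Perm.prod_Ioi_comp_eq_sign_mul_prod _ fun i j ↦ hf (o i) (o j)]
  simp

section Pfaffian

variable {n : ℕ}

/-- The position of a vertex in the boundary order `T_1, …, T_n, B_n, …, B_1`. -/
def boundaryPos : BVertex n → ℤ
  | .inl i => i
  | .inr m => 2 * n - m

theorem boundaryPos_injective : Function.Injective (boundaryPos (n := n)) := by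
  rintro (i | i) (j | j) h <;> simp only [boundaryPos] at h <;>
    first
    | (congr 1; ext; omega)
    | (exfalso; omega)

/-- The sign recording the relative boundary order of two vertices. -/
def boundarySign (x y : BVertex n) : ℤ := (boundaryPos y - boundaryPos x).sign

theorem boundarySign_swap (x y : BVertex n) : boundarySign x y = -boundarySign y x := by
  rw [boundarySign, boundarySign, ← Int.sign_neg, neg_sub]

theorem boundarySign_of_lt {x y : BVertex n} (h : boundaryPos x < boundaryPos y) :
    boundarySign x y = 1 := Int.sign_eq_one_of_pos (by omega)

theorem boundarySign_of_gt {x y : BVertex n} (h : boundaryPos y < boundaryPos x) :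
    boundarySign x y = -1 := Int.sign_eq_neg_one_of_neg (by omega)

theorem boundarySign_inl_inl (i j : Fin n) :
    boundarySign (.inl i) (.inl j) = ((j : ℤ) - i).sign := rfl

theorem boundarySign_inr_inr (i j : Fin n) :
    boundarySign (.inr i) (.inr j) = ((i : ℤ) - j).sign := by
  simp [boundarySign, boundaryPos]

theorem boundarySign_inl_inr (i j : Fin n) : boundarySign (.inl i) (.inr j) = 1 :=
  boundarySign_of_lt (by simp only [boundaryPos]; omega)

theorem boundarySign_inr_inl (i j : Fin n) : boundarySign (.inr i) (.inl j) = -1 :=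
  boundarySign_of_gt (by simp only [boundaryPos]; omega)

theorem sign_val_sub (i j : Fin n) (h : i ≠ j) :
    ((j : ℤ) - i).sign = if i < j then 1 else -1 := by
  split_ifs with hij
  · exact Int.sign_eq_one_of_pos (by omega)
  · exact Int.sign_eq_neg_one_of_neg (by omega)

theorem edgeOf_comm (x y : BVertex n) : edgeOf x y = edgeOf y x := by
  rcases x with i | i <;> rcases y with j | j <;> simp [edgeOf, min_comm, max_comm]

theorem crosses_comm (e f : BEdge n) : crosses e f = crosses f e := by
  cases e <;> cases f <;> simp only [crosses] <;> congr 1 <;> grind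

/-- Two disjoint edges cross if and only if their endpoints interleave on the boundary. -/
theorem prod_boundarySign_eq_crosses {x y z w : BVertex n} (hxy : x ≠ y) (hzw : z ≠ w)
    (hxz : x ≠ z) (hxw : x ≠ w) (hyz : y ≠ z) (hyw : y ≠ w) :
    boundarySign x z * boundarySign x w * boundarySign y z * boundarySign y w =
      if crosses (edgeOf x y) (edgeOf z w) = true then -1 else 1 := by
  rcases x with x | x <;> rcases y with y | y <;> rcases z with z | z <;> rcases w with w | w <;>
    simp only [edgeOf, crosses, boundarySign_inl_inl, boundarySign_inr_inr,
      boundarySign_inl_inr, boundarySign_inr_inl, ne_eq, Sum.inl.injEq, Sum.inr.injEq,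
      decide_eq_true_eq, min_def, max_def] at * <;>
    grind (splits := 20) [sign_val_sub]

/-- An enumeration of the edges of a Brauer diagram with a chosen orientation of each edge. -/
def BrauerDiagram.IsEnumeration (μ : BrauerDiagram n) (e : Fin n ×ₗ Bool ≃ BVertex n) : Prop :=
  ∀ i, μ.1 (e (toLex (i, false))) = e (toLex (i, true))

theorem BrauerDiagram.exists_isEnumeration (μ : BrauerDiagram n) : ∃ e, μ.IsEnumeration e := by
  obtain ⟨μ, hinv, hfix⟩ := μ
  let O : Finset (BVertex n) := {x | boundaryPos x < boundaryPos (μ x)}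
  have hmem (x : BVertex n) : x ∈ O ↔ boundaryPos x < boundaryPos (μ x) := by simp [O]
  have hne (x : BVertex n) : boundaryPos x ≠ boundaryPos (μ x) :=
    fun h ↦ hfix x (boundaryPos_injective h).symm
  have hcompl : Oᶜ = O.map μ.toEmbedding := by
    ext x
    rw [Finset.mem_map_equiv, Finset.mem_compl, hmem, hmem, μ.apply_symm_apply,
      show μ.symm x = μ x from μ.symm_apply_eq.2 (hinv x).symm]
    have := hne x
    omega
  have hcard : O.card = n := by
    have h := O.card_add_card_compl
    rw [hcompl, Finset.card_map, Fintype.card_sum, Fintype.card_fin] at h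
    omega
  let o : Fin n ≃ O := (O.equivFinOfCardEq hcard).symm
  have ho (i : Fin n) : boundaryPos (o i : BVertex n) < boundaryPos (μ (o i)) :=
    (hmem _).1 (o i).2
  let g : Fin n ×ₗ Bool → BVertex n := fun p ↦
    bif (ofLex p).2 then μ (o (ofLex p).1) else o (ofLex p).1
  have hg : Function.Injective g := by
    rintro ⟨i, c⟩ ⟨j, d⟩ h
    have hi := ho i
    have hj := ho j
    cases c <;> cases d
    · obtain rfl := o.injective (Subtype.ext h)
      rfl
    · replace h : (o i : BVertex n) = μ (o j) := h
      rw [h, hinv] at hi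
      omega
    · replace h : μ (o i) = (o j : BVertex n) := h
      rw [← h, hinv] at hj
      omega
    · obtain rfl := o.injective (Subtype.ext (μ.injective h))
      rfl
  refine ⟨Equiv.ofBijective g ((Fintype.bijective_iff_injective_and_card g).2 ⟨hg, ?_⟩),
    fun i ↦ rfl⟩
  rw [Fintype.card_sum, Fintype.card_fin, Fintype.card_lex, Fintype.card_prod, Fintype.card_fin,
    Fintype.card_bool]
  omega

/-- The sign of an enumeration of the vertices, relative to the boundary order. -/
def enumSign (e : Fin n ×ₗ Bool ≃ BVertex n) : ℤ :=
  ∏ p, ∏ q, if p < q then boundarySign (e p) (e q) else 1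

theorem enumSign_trans_swap (e : Fin n ×ₗ Bool ≃ BVertex n) {x y : BVertex n} (hxy : x ≠ y) :
    enumSign (e.trans (Equiv.swap x y)) = -enumSign e := by
  have h := Equiv.Perm.prod_ite_lt_comp_eq_sign_mul_prod (e.symm.permCongr (Equiv.swap x y))
    fun p q ↦ boundarySign_swap (e p) (e q)
  rw [Equiv.Perm.sign_permCongr, Equiv.Perm.sign_swap hxy] at h
  simpa [enumSign] using h

/-- The edge with index `i` in an enumeration. -/
def enumEdge (e : Fin n ×ₗ Bool ≃ BVertex n) (i : Fin n) : BEdge n :=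
  edgeOf (e (toLex (i, false))) (e (toLex (i, true)))

theorem enumSign_eq (e : Fin n ×ₗ Bool ≃ BVertex n) :
    enumSign e = (∏ i, boundarySign (e (toLex (i, false))) (e (toLex (i, true)))) *
      ∏ i, ∏ j, if i < j ∧ crosses (enumEdge e i) (enumEdge e j) = true then -1 else 1 := by
  have hsplit (f : Fin n ×ₗ Bool → ℤ) :
      ∏ p, f p = ∏ i, f (toLex (i, false)) * f (toLex (i, true)) := by
    rw [← toLex.prod_comp, Fintype.prod_prod_type]
    exact Finset.prod_congr rfl fun i _ ↦ by rw [Fintype.prod_bool, mul_comm]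
  have hdiag (g : Fin n → ℤ) : ∏ i, g i = ∏ i, ∏ j, if i = j then g i else 1 := by simp
  rw [enumSign, hsplit,
    hdiag fun i ↦ boundarySign (e (toLex (i, false))) (e (toLex (i, true))), ← Finset.prod_mul_distrib]
  refine Finset.prod_congr rfl fun i _ ↦ ?_
  rw [hsplit, hsplit, ← Finset.prod_mul_distrib, ← Finset.prod_mul_distrib]
  refine Finset.prod_congr rfl fun j _ ↦ ?_
  simp only [Prod.Lex.toLex_lt_toLex]
  obtain h | rfl | h := lt_trichotomy i j
  · have hne (c d : Bool) : e (toLex (i, c)) ≠ e (toLex (j, d)) := fun h' ↦ by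
      simpa [h.ne] using e.injective h'
    have hne' (k : Fin n) : e (toLex (k, false)) ≠ e (toLex (k, true)) := fun h' ↦ by
      simpa using e.injective h'
    have := prod_boundarySign_eq_crosses (hne' i) (hne' j) (hne _ _) (hne _ _) (hne _ _) (hne _ _)
    simp only [h, h.ne, true_or, if_true, if_false, true_and, one_mul, enumEdge]
    rw [← this]
    ring
  · simp
  · simp [h.not_gt, h.ne']

variable {μ : BrauerDiagram n} {e : Fin n ×ₗ Bool ≃ BVertex n}

theorem BrauerDiagram.IsEnumeration.edges_eq (he : μ.IsEnumeration e) :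
    edges μ = Finset.univ.image (enumEdge e) := by
  ext f
  simp only [edges, Finset.mem_image, Finset.mem_univ, true_and, enumEdge]
  constructor
  · rintro ⟨x, rfl⟩
    obtain ⟨⟨i, c⟩, rfl⟩ := e.surjective x
    refine ⟨i, ?_⟩
    cases c
    · exact congrArg _ (he i).symm
    · rw [edgeOf_comm, ← he i]
      change _ = edgeOf (e (toLex (i, true))) (μ.1 (e (toLex (i, true))))
      rw [← he i, μ.2.1]
  · rintro ⟨i, rfl⟩
    exact ⟨e (toLex (i, false)), by rw [he i]⟩

theorem edgeOf_eq_edgeOf {x y z w : BVertex n} (h : edgeOf x y = edgeOf z w) :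
    x = z ∨ x = w := by
  rcases x with x | x <;> rcases y with y | y <;> rcases z with z | z <;> rcases w with w | w <;>
    simp only [edgeOf, BEdge.cup.injEq, BEdge.cap.injEq, BEdge.arc.injEq, reduceCtorEq,
      Sum.inl.injEq, Sum.inr.injEq] at * <;> grind

theorem enumEdge_injective (e : Fin n ×ₗ Bool ≃ BVertex n) : Function.Injective (enumEdge e) := by
  intro i j h
  obtain h | h := edgeOf_eq_edgeOf h <;> simpa using congrArg (fun p ↦ (ofLex p).1) (e.injective h)

theorem BrauerDiagram.IsEnumeration.neg_one_pow_crossingNumber (he : μ.IsEnumeration e) :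
    (-1 : ℤ) ^ crossingNumber μ =
      ∏ i, ∏ j, if i < j ∧ crosses (enumEdge e i) (enumEdge e j) = true then -1 else 1 := by
  let c : Fin n × Fin n → Prop := fun p ↦ crosses (enumEdge e p.1) (enumEdge e p.2) = true
  let S : Finset (Fin n × Fin n) := {p | p.1 < p.2 ∧ c p}
  let S' : Finset (Fin n × Fin n) := {p | p.2 < p.1 ∧ c p}
  have hS : S'.card = S.card := by
    refine Finset.card_equiv (Equiv.prodComm _ _) fun p ↦ ?_
    simp [S, S', c, crosses_comm (enumEdge e p.1)]
  have hcross : ((edges μ).offDiag.filter fun p => crosses p.1 p.2 = true).card = 2 * S.card := by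
    rw [two_mul]
    nth_rw 2 [← hS]
    rw [← Finset.card_union_of_disjoint]
    · refine (Finset.card_bij (fun p _ ↦ (enumEdge e p.1, enumEdge e p.2)) ?_ ?_ ?_).symm
      · rintro ⟨i, j⟩ h
        have hij : i ≠ j := by rintro rfl; simp [S, S'] at h
        have hc : crosses (enumEdge e i) (enumEdge e j) = true := by
          simp only [S, S', c, Finset.mem_union, Finset.mem_filter, Finset.mem_univ] at h
          tauto
        simp [he.edges_eq, hc, (enumEdge_injective e).ne hij]
      · rintro ⟨i, j⟩ - ⟨k, l⟩ - h
        simpa [(enumEdge_injective e).eq_iff] using h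
      · rintro ⟨f, g⟩ h
        simp only [he.edges_eq, Finset.mem_filter, Finset.mem_offDiag, Finset.mem_image,
          Finset.mem_univ, true_and] at h
        obtain ⟨⟨⟨i, rfl⟩, ⟨j, rfl⟩, hij⟩, hc⟩ := h
        refine ⟨(i, j), ?_, rfl⟩
        have : i ≠ j := fun h ↦ hij (congrArg _ h)
        have := lt_or_gt_of_ne this
        simp only [S, S', c, Finset.mem_union, Finset.mem_filter, Finset.mem_univ]
        tauto
    · rw [Finset.disjoint_left]
      simp only [S, S', Finset.mem_filter]
      rintro p ⟨-, h, -⟩ ⟨-, h', -⟩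
      exact h.not_gt h'
  rw [crossingNumber, hcross, Nat.mul_div_cancel_left _ two_pos, ← Fintype.prod_prod_type',
    Finset.prod_ite]
  simp [S, c]

theorem lt_of_cup_mem_edges {i j : Fin n} (h : .cup i j ∈ edges μ) : i < j := by
  obtain ⟨x, -, hx⟩ := Finset.mem_image.1 h
  have hne := μ.2.2 x
  generalize μ.1 x = y at hx hne
  rcases x with x | x <;> rcases y with y | y <;>
    simp only [edgeOf, reduceCtorEq, BEdge.cup.injEq, ne_eq, Sum.inl.injEq] at hx hne
  grind

theorem lt_of_cap_mem_edges {i j : Fin n} (h : .cap i j ∈ edges μ) : i < j := by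
  obtain ⟨x, -, hx⟩ := Finset.mem_image.1 h
  have hne := μ.2.2 x
  generalize μ.1 x = y at hx hne
  rcases x with x | x <;> rcases y with y | y <;>
    simp only [edgeOf, reduceCtorEq, BEdge.cap.injEq, ne_eq, Sum.inr.injEq] at hx hne
  grind

section CommRing

variable {R E : Type*} [CommRing R] [AddCommGroup E] [Module R E]

/-- The weight of an edge when vertices are labelled by vectors and edges are weighted by a
bilinear form, oriented along the boundary order. -/
def edgeForm (P : LinearMap.BilinForm R E) (v : BVertex n → E) : BEdge n → R
  | .cup i j => P (v (.inl i)) (v (.inl j))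
  | .cap i j => P (v (.inr j)) (v (.inr i))
  | .arc i m => P (v (.inl i)) (v (.inr m))

theorem edgeForm_edgeOf {P : LinearMap.BilinForm R E} (hP : P.IsAlt) (v : BVertex n → E)
    {x y : BVertex n} (hxy : x ≠ y) :
    edgeForm P v (edgeOf x y) = boundarySign x y * P (v x) (v y) := by
  rcases x with i | i <;> rcases y with j | j
  · replace hxy : i ≠ j := fun h ↦ hxy (congrArg _ h)
    rw [boundarySign_inl_inl, sign_val_sub _ _ hxy]
    obtain h | h := lt_or_gt_of_ne hxy
    · simp [edgeOf, edgeForm, h, h.le]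
    · simp [edgeOf, edgeForm, h.not_gt, h.le, hP.neg_eq]
  · simp [edgeOf, edgeForm, boundarySign_inl_inr]
  · simp [edgeOf, edgeForm, boundarySign_inr_inl, hP.neg_eq]
  · replace hxy : i ≠ j := fun h ↦ hxy (congrArg _ h)
    rw [boundarySign_inr_inr, sign_val_sub _ _ hxy.symm]
    obtain h | h := lt_or_gt_of_ne hxy
    · simp [edgeOf, edgeForm, h.not_gt, h.le, hP.neg_eq]
    · simp [edgeOf, edgeForm, h, h.le]

/-- The signed weight of a Brauer diagram whose vertices are labelled by vectors. -/
def brauerTerm (P : LinearMap.BilinForm R E) (v : BVertex n → E) (μ : BrauerDiagram n) : R :=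
  (-1) ^ crossingNumber μ * ∏ f ∈ edges μ, edgeForm P v f

theorem BrauerDiagram.IsEnumeration.brauerTerm_eq (he : μ.IsEnumeration e)
    {P : LinearMap.BilinForm R E} (hP : P.IsAlt) (v : BVertex n → E) :
    brauerTerm P v μ = enumSign e *
      ∏ i, P (v (e (toLex (i, false)))) (v (e (toLex (i, true)))) := by
  have hne (i : Fin n) : e (toLex (i, false)) ≠ e (toLex (i, true)) := fun h ↦ by
    simpa using e.injective h
  have hpow : (-1 : R) ^ crossingNumber μ = (((-1 : ℤ) ^ crossingNumber μ : ℤ) : R) := by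
    push_cast
    rfl
  rw [brauerTerm, hpow, he.neg_one_pow_crossingNumber, he.edges_eq,
    Finset.prod_image (enumEdge_injective e).injOn, enumSign_eq, Int.cast_mul,
    Int.cast_prod (s := Finset.univ) (f := fun i ↦ boundarySign _ _)]
  simp only [enumEdge, edgeForm_edgeOf hP v (hne _), Finset.prod_mul_distrib]
  ring

theorem brauerTerm_update_add {P : LinearMap.BilinForm R E} (hP : P.IsAlt) (v : BVertex n → E)
    (x : BVertex n) (p q : E) (μ : BrauerDiagram n) :
    brauerTerm P (Function.update v x (p + q)) μ =
      brauerTerm P (Function.update v x p) μ + brauerTerm P (Function.update v x q) μ := by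
  obtain ⟨e, he⟩ := μ.exists_isEnumeration
  obtain ⟨⟨i, c⟩, rfl⟩ := e.surjective x
  have hrest (r : E) : ∏ j ∈ Finset.univ.erase i,
      P (Function.update v (e (toLex (i, c))) r (e (toLex (j, false))))
        (Function.update v (e (toLex (i, c))) r (e (toLex (j, true)))) =
      ∏ j ∈ Finset.univ.erase i, P (v (e (toLex (j, false)))) (v (e (toLex (j, true)))) := by
    refine Finset.prod_congr rfl fun j hj ↦ ?_
    have hne (d : Bool) : e (toLex (j, d)) ≠ e (toLex (i, c)) := fun h ↦
      Finset.ne_of_mem_erase hj (by simpa using congrArg (fun p ↦ (ofLex p).1) (e.injective h))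
    rw [Function.update_of_ne (hne _), Function.update_of_ne (hne _)]
  change brauerTerm P (Function.update v (e (toLex (i, c))) (p + q)) μ =
    brauerTerm P (Function.update v (e (toLex (i, c))) p) μ +
      brauerTerm P (Function.update v (e (toLex (i, c))) q) μ
  simp only [he.brauerTerm_eq hP, ← Finset.mul_prod_erase _ _ (Finset.mem_univ i), hrest]
  cases c <;> simp <;> ring

/-- Conjugating a Brauer diagram by a permutation of the vertices. -/
def BrauerDiagram.conj (σ : Equiv.Perm (BVertex n)) (μ : BrauerDiagram n) : BrauerDiagram n :=
  ⟨σ.permCongr μ.1, fun x ↦ by simp [μ.2.1], fun x h ↦ μ.2.2 (σ.symm x) (by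
    rw [Equiv.permCongr_apply] at h
    rw [← σ.symm_apply_apply (μ.1 _), h])⟩

theorem BrauerDiagram.IsEnumeration.conj (he : μ.IsEnumeration e) (σ : Equiv.Perm (BVertex n)) :
    (μ.conj σ).IsEnumeration (e.trans σ) := fun i ↦ by
  simp [BrauerDiagram.conj, he i]

theorem brauerTerm_conj_swap {P : LinearMap.BilinForm R E} (hP : P.IsAlt) {v : BVertex n → E}
    {x y : BVertex n} (hxy : x ≠ y) (hv : v x = v y) (μ : BrauerDiagram n) :
    brauerTerm P v (μ.conj (Equiv.swap x y)) = -brauerTerm P v μ := by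
  obtain ⟨e, he⟩ := μ.exists_isEnumeration
  have hswap (z : BVertex n) : v (Equiv.swap x y z) = v z := by
    rw [Equiv.swap_apply_def]
    split_ifs <;> simp_all
  simp [(he.conj _).brauerTerm_eq hP, he.brauerTerm_eq hP, enumSign_trans_swap e hxy, hswap]

/-- The sum of the signed weights of all Brauer diagrams. -/
def brauerSum (P : LinearMap.BilinForm R E) (v : BVertex n → E) : R :=
  ∑ μ : BrauerDiagram n, brauerTerm P v μ

theorem brauerSum_update_add {P : LinearMap.BilinForm R E} (hP : P.IsAlt) (v : BVertex n → E)
    (x : BVertex n) (p q : E) :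
    brauerSum P (Function.update v x (p + q)) =
      brauerSum P (Function.update v x p) + brauerSum P (Function.update v x q) := by
  simp [brauerSum, brauerTerm_update_add hP, Finset.sum_add_distrib]

theorem brauerSum_eq_zero_of_eq {P : LinearMap.BilinForm R E} (hP : P.IsAlt) {v : BVertex n → E}
    {x y : BVertex n} (hxy : x ≠ y) (hv : v x = v y) : brauerSum P v = 0 := by
  refine Finset.sum_involution (fun μ _ ↦ μ.conj (Equiv.swap x y)) (fun μ _ ↦ ?_)
    (fun μ _ hne hfix ↦ hne ?_) (fun _ _ ↦ Finset.mem_univ _) fun μ _ ↦ ?_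
  · rw [brauerTerm_conj_swap hP hxy hv, add_neg_cancel]
  · have hμ (z : BVertex n) : Equiv.swap x y (μ.1 (Equiv.swap x y z)) = μ.1 z := by
      conv_rhs => rw [← hfix]
      simp [BrauerDiagram.conj]
    have hμx : μ.1 x = y := by
      by_contra h
      have h1 := hμ y
      rw [Equiv.swap_apply_right, Equiv.swap_apply_of_ne_of_ne (μ.2.2 x) h] at h1
      exact hxy (μ.1.injective h1)
    have hmem : edgeOf x y ∈ edges μ :=
      Finset.mem_image.2 ⟨x, Finset.mem_univ _, by rw [hμx]⟩
    rw [brauerTerm, Finset.prod_eq_zero hmem, mul_zero]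
    rw [edgeForm_edgeOf hP v hxy, hv, hP.self_eq_zero, mul_zero]
  · exact Subtype.ext (Equiv.ext fun z ↦ by simp [BrauerDiagram.conj])

theorem brauerSum_update_add_self {P : LinearMap.BilinForm R E} (hP : P.IsAlt)
    (v : BVertex n → E) {x y : BVertex n} (hxy : x ≠ y) :
    brauerSum P (Function.update v x (v x + v y)) = brauerSum P v := by
  rw [brauerSum_update_add hP, Function.update_eq_self,
    brauerSum_eq_zero_of_eq hP (v := Function.update v x (v y)) hxy (by simp [hxy.symm]), add_zero]

theorem brauerSum_add_top {P : LinearMap.BilinForm R E} (hP : P.IsAlt) (t u : Fin n → E) :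
    brauerSum P (Sum.elim t fun i ↦ u i + t i) = brauerSum P (Sum.elim t u) := by
  have key (K : Finset (Fin n)) :
      brauerSum P (Sum.elim t fun i ↦ if i ∈ K then u i + t i else u i) =
        brauerSum P (Sum.elim t u) := by
    induction K using Finset.induction_on with
    | empty => simp
    | insert k K hk ih =>
      rw [← ih]
      refine Eq.trans ?_ (brauerSum_update_add_self hP _ (x := .inr k) (y := .inl k) Sum.inr_ne_inl)
      congr 1
      ext x
      rcases x with i | i
      · simp
      · rcases eq_or_ne i k with rfl | h
        · simp [hk]
        · simp [h]
  simpa using key Finset.univ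

/-- The Brauer diagram without cups and caps joining `B m` to `T (σ m)`. -/
def BrauerDiagram.ofPerm (σ : Equiv.Perm (Fin n)) : BrauerDiagram n :=
  ⟨⟨Sum.elim (fun i ↦ .inr (σ.symm i)) (fun m ↦ .inl (σ m)),
    Sum.elim (fun i ↦ .inr (σ.symm i)) (fun m ↦ .inl (σ m)),
    by rintro (i | i) <;> simp, by rintro (i | i) <;> simp⟩,
    by rintro (i | i) <;> simp, by rintro (i | i) <;> simp⟩

/-- The enumeration of the arcs of `BrauerDiagram.ofPerm σ` by their bottom endpoints. -/
def enumOfPerm (σ : Equiv.Perm (Fin n)) : Fin n ×ₗ Bool ≃ BVertex n where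
  toFun p := bif (ofLex p).2 then .inr (ofLex p).1 else .inl (σ (ofLex p).1)
  invFun := Sum.elim (fun i ↦ toLex (σ.symm i, false)) fun m ↦ toLex (m, true)
  left_inv := by
    rintro ⟨i, _ | _⟩
    · exact congrArg (fun k ↦ toLex (k, false)) (σ.symm_apply_apply i)
    · rfl
  right_inv := by rintro (i | i) <;> simp

theorem isEnumeration_enumOfPerm (σ : Equiv.Perm (Fin n)) :
    (BrauerDiagram.ofPerm σ).IsEnumeration (enumOfPerm σ) := fun i ↦ by
  simp [enumOfPerm, BrauerDiagram.ofPerm]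

theorem enumEdge_enumOfPerm (σ : Equiv.Perm (Fin n)) (i : Fin n) :
    enumEdge (enumOfPerm σ) i = .arc (σ i) i := rfl

theorem edges_ofPerm (σ : Equiv.Perm (Fin n)) :
    edges (BrauerDiagram.ofPerm σ) = Finset.univ.image fun i ↦ .arc (σ i) i :=
  (isEnumeration_enumOfPerm σ).edges_eq

theorem neg_one_pow_crossingNumber_ofPerm (σ : Equiv.Perm (Fin n)) :
    (-1 : ℤ) ^ crossingNumber (BrauerDiagram.ofPerm σ) = σ.sign := by
  rw [(isEnumeration_enumOfPerm σ).neg_one_pow_crossingNumber, Equiv.Perm.sign_eq_prod_prod_Ioi]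
  push_cast
  refine Finset.prod_congr rfl fun i _ ↦ ?_
  rw [← Finset.filter_lt_eq_Ioi, Finset.prod_filter]
  refine Finset.prod_congr rfl fun j _ ↦ ?_
  by_cases h : i < j
  · obtain h' | h' := lt_or_gt_of_ne (σ.injective.ne h.ne)
    · simp [enumEdge_enumOfPerm, crosses, h, h.not_gt, h', h'.not_gt]
    · simp [enumEdge_enumOfPerm, crosses, h, h', h'.not_gt]
  · simp [h]

theorem BrauerDiagram.exists_eq_ofPerm (μ : BrauerDiagram n)
    (h : ∀ m k, μ.1 (.inr m) ≠ .inr k) : ∃ σ, BrauerDiagram.ofPerm σ = μ := by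
  have h' (m : Fin n) : ∃ i, μ.1 (.inr m) = .inl i := by
    rcases hm : μ.1 (.inr m) with i | k
    · exact ⟨i, rfl⟩
    · exact absurd hm (h m k)
  choose g hg using h'
  have hginj : Function.Injective g := fun i j hij ↦ by
    have : μ.1 (.inr i) = μ.1 (.inr j) := by rw [hg, hg, hij]
    simpa using μ.1.injective this
  let σ := Equiv.ofBijective g (Finite.injective_iff_bijective.1 hginj)
  have hσ (m : Fin n) : μ.1 (.inr m) = .inl (σ m) := hg m
  refine ⟨σ, Subtype.ext (Equiv.ext ?_)⟩
  rintro (i | m)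
  · obtain ⟨m, rfl⟩ := σ.surjective i
    rw [← hσ, μ.2.1, hσ]
    simp [BrauerDiagram.ofPerm]
  · exact (hσ m).symm

/-- If no two bottom labels pair nontrivially, only diagrams without caps contribute, and the
sum is a determinant. -/
theorem brauerSum_eq_det (P : LinearMap.BilinForm R E) (t u : Fin n → E)
    (hu : ∀ i j, P (u i) (u j) = 0) :
    brauerSum P (Sum.elim t u) = (Matrix.of fun i j ↦ P (t i) (u j)).det := by
  rw [Matrix.det_apply']
  refine (Finset.sum_of_injOn BrauerDiagram.ofPerm ?_ (by simp) ?_ fun σ _ ↦ ?_).symm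
  · intro σ _ τ _ h
    ext i : 1
    simpa [BrauerDiagram.ofPerm] using
      congrArg (fun μ : BrauerDiagram n ↦ μ.1 (Sum.inr i)) h
  · intro μ _ hμ
    have : ∃ m k, μ.1 (.inr m) = .inr k := by
      by_contra! h
      obtain ⟨σ, hσ⟩ := μ.exists_eq_ofPerm h
      exact hμ ⟨σ, by simp, hσ⟩
    obtain ⟨m, k, h⟩ := this
    have hmem : edgeOf (.inr m) (.inr k) ∈ edges μ :=
      Finset.mem_image.2 ⟨.inr m, Finset.mem_univ _, by rw [h]⟩
    rw [brauerTerm, Finset.prod_eq_zero hmem, mul_zero]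
    simp [edgeOf, edgeForm, hu]
  · rw [brauerTerm, edges_ofPerm, Finset.prod_image fun i _ j _ h ↦ by simpa using h,
      ← neg_one_pow_crossingNumber_ofPerm]
    simp [edgeForm]

end CommRing

end Pfaffian

theorem Matrix.toBilin'_isAlt {ι R : Type*} [Fintype ι] [DecidableEq ι] [CommRing R]
    {M : Matrix ι ι R} (hM : ∀ i j, M i j = -M j i) (hM0 : ∀ i, M i i = 0) :
    (Matrix.toBilin' M).IsAlt := fun x ↦ by
  rw [Matrix.toBilin'_apply, ← Fintype.sum_prod_type' fun i j ↦ x i * M i j * x j]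
  refine Finset.sum_involution (fun p _ ↦ p.swap) (fun p _ ↦ ?_) (fun p _ hne h ↦ hne ?_)
    (fun _ _ ↦ Finset.mem_univ _) fun p _ ↦ p.swap_swap
  · rw [hM p.1 p.2]
    simp only [Prod.fst_swap, Prod.snd_swap]
    ring
  · rw [show p.2 = p.1 from congrArg Prod.fst h, hM0, mul_zero, zero_mul]

/-- Theorem (determinant as a sum over `F`-labeled Brauer diagrams):
`det M_F = ∑_μ (-1)^{χ(μ)} w_F(μ)`. -/
theorem det_MF_eq_sum_brauer (n : ℕ) (hn : 1 ≤ n) (R : Type*) [CommRing R]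
    (a b : Fin n → Fin n → R) :
    (MF a b).det =
      ∑ μ : BrauerDiagram n,
        (-1 : R) ^ crossingNumber μ * ∏ e ∈ edges μ, wF a b e := by
  let A (i j : Fin n) : R := a (min i j) (max i j)
  let B (i j : Fin n) : R := if i < j then b i j else if j < i then -b j i else 0
  have hA (i j : Fin n) : A i j = A j i := by simp only [A, min_comm, max_comm]
  have hB (i j : Fin n) : B i j = -B j i := by simp only [B]; grind
  have hB0 (i : Fin n) : B i i = 0 := by simp [B]
  let M : Matrix (Fin n ⊕ Fin n) (Fin n ⊕ Fin n) R :=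
    Matrix.fromBlocks (.of B) (.of A) (-.of A) (-.of B)
  let P := Matrix.toBilin' M
  let t (i : Fin n) : Fin n ⊕ Fin n → R := Pi.single (.inl i) 1
  let u (i : Fin n) : Fin n ⊕ Fin n → R := Pi.single (.inr i) 1
  have htt (i j : Fin n) : P (t i) (t j) = B i j := Matrix.toBilin'_single M _ _
  have htu (i j : Fin n) : P (t i) (u j) = A i j := Matrix.toBilin'_single M _ _
  have hut (i j : Fin n) : P (u i) (t j) = -A i j := Matrix.toBilin'_single M _ _
  have huu (i j : Fin n) : P (u i) (u j) = -B i j := Matrix.toBilin'_single M _ _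
  have hP : P.IsAlt := Matrix.toBilin'_isAlt
    (by rintro (i | i) (j | j) <;> simp [M, ← hB, hA i j])
    (by rintro (i | i) <;> simp [M, hB0])
  have hsum : brauerSum P (Sum.elim t u) =
      ∑ μ : BrauerDiagram n, (-1 : R) ^ crossingNumber μ * ∏ e ∈ edges μ, wF a b e := by
    refine Finset.sum_congr rfl fun μ _ ↦ congrArg _ (Finset.prod_congr rfl fun f hf ↦ ?_)
    cases f with
    | cup i j => simp [edgeForm, wF, htt, B, lt_of_cup_mem_edges hf]
    | cap i j =>
      have h := lt_of_cap_mem_edges hf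
      simp [edgeForm, wF, huu, B, h, h.not_gt]
    | arc i m => simp [edgeForm, wF, htu, A]
  rw [← hsum, ← brauerSum_add_top hP, brauerSum_eq_det]
  · congr 1
    ext i j
    simp only [MF, Matrix.of_apply, map_add, htt, htu, A, B]
    obtain h | rfl | h := lt_trichotomy i j
    · simp [h, h.le]
    · simp
    · simp [h, h.le, h.not_gt, sub_eq_add_neg]
  · intro i j
    simp only [map_add, LinearMap.add_apply, htt, htu, hut, huu]
    ring
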